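/- Let G be a prime tournament that contains T_5 as a subtournament. Then either G is isomorphic to T_n for some odd n, or G contains both U_5 and W_5 as subtournaments. -/

import Mathlib

/-- A tournament: irreflexive, and between any two distinct vertices exactly one edge. -/
def IsTournament {V : Type*} (r : V → V → Prop) : Prop :=
  (∀ v, ¬ r v v) ∧ ∀ u v : V, u ≠ v → (r u v ↔ ¬ r v u)

/-- A homogeneous set. -/
def IsHomog {V : Type*} (r : V → V → Prop) (X : Set V) : Prop :=
  ∀ v ∉ X, (∀ x ∈ X, r v x) ∨ (∀ x ∈ X, r x v)

/-- A prime tournament: every homogeneous set is trivial. -/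
def IsPrime {V : Type*} (r : V → V → Prop) : Prop :=
  ∀ X : Set V, IsHomog r X → X.Subsingleton ∨ X = Set.univ

/-- A set of vertices is transitive: it induces no cyclic triangle. -/
def IsTransOn {V : Type*} (r : V → V → Prop) (X : Set V) : Prop :=
  ∀ a ∈ X, ∀ b ∈ X, ∀ c ∈ X, ¬ (r a b ∧ r b c ∧ r c a)

/-- T_5: vertices 0,...,4 (v_k = k-1), with i → j iff j - i ≡ 1 or 2 (mod 5). -/
def T5 (i j : Fin 5) : Prop :=
  (j.val + 5 - i.val) % 5 = 1 ∨ (j.val + 5 - i.val) % 5 = 2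

/-- U_5: obtained from T_5 by reversing the edge between v_1 and v_2
(indices 0 and 1), so that v_2 → v_1. -/
def U5 (i j : Fin 5) : Prop :=
  if i = 0 ∧ j = 1 then False else if i = 1 ∧ j = 0 then True else T5 i j

/-- G (given by relation r) contains a copy of the tournament given by s. -/
def Copy {V W : Type*} (r : V → V → Prop) (s : W → W → Prop) : Prop :=
  ∃ f : W → V, Function.Injective f ∧ ∀ a b, s a b → r (f a) (f b)

/-- T_n. -/
def Tn (n : ℕ) (i j : Fin n) : Prop :=
  1 ≤ (j.val + n - i.val) % n ∧ (j.val + n - i.val) % n ≤ (n - 1) / 2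

/-- W_5: vertex 0 is v, vertices 1..4 are w_1..w_4. -/
def W5 (i j : Fin 5) : Prop :=
  if i.val = 0 then j.val % 2 = 1
  else if j.val = 0 then i.val % 2 = 0
  else i.val < j.val

/-- The vertices `a, b, c, d, e`, in this cyclic order, induce a copy of `T5`. -/
def IsPentagon {V : Type*} (r : V → V → Prop) (a b c d e : V) : Prop :=
  (r a b ∧ r b c ∧ r c d ∧ r d e ∧ r e a) ∧ (r a c ∧ r b d ∧ r c e ∧ r d a ∧ r e b)

/-- For every copy of `T5`, each vertex can replace one of the five vertices. -/
def PentagonsAbsorb {V : Type*} (r : V → V → Prop) : Prop :=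
  ∀ a b c d e : V, IsPentagon r a b c d e → ∀ x : V,
    IsPentagon r x b c d e ∨ IsPentagon r a x c d e ∨ IsPentagon r a b x d e ∨
      IsPentagon r a b c x e ∨ IsPentagon r a b c d x

section Tournament

variable {V : Type*} {r : V → V → Prop}

theorem IsTournament.irrefl (hT : IsTournament r) (v : V) : ¬ r v v := hT.1 v

theorem IsTournament.asymm (hT : IsTournament r) {u v : V} (h : r u v) : ¬ r v u := by
  have hne : u ≠ v := by rintro rfl; exact hT.1 _ h
  exact (hT.2 u v hne).1 h

theorem IsTournament.total (hT : IsTournament r) {u v : V} (h : u ≠ v) : r u v ∨ r v u := by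
  by_contra! hn
  exact hn.1 ((hT.2 u v h).2 hn.2)

theorem IsPentagon.rotate {a b c d e : V} (h : IsPentagon r a b c d e) :
    IsPentagon r b c d e a := by
  obtain ⟨⟨h1, h2, h3, h4, h5⟩, h6, h7, h8, h9, h10⟩ := h
  exact ⟨⟨h2, h3, h4, h5, h1⟩, h7, h8, h9, h10, h6⟩

theorem Copy.exists_isPentagon (h : Copy r T5) : ∃ a b c d e, IsPentagon r a b c d e := by
  obtain ⟨f, -, hf⟩ := h
  refine ⟨f 0, f 1, f 2, f 3, f 4, ⟨?_, ?_, ?_, ?_, ?_⟩, ?_, ?_, ?_, ?_, ?_⟩ <;>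
    exact hf _ _ (by simp [T5])

theorem copy_U5_of_rel (hT : IsTournament r) {a b c d e : V} (ba : r b a) (ac : r a c)
    (bc : r b c) (bd : r b d) (cd : r c d) (ce : r c e) (de : r d e) (da : r d a) (ea : r e a)
    (eb : r e b) : Copy r U5 := by
  have hU : ∀ i j, U5 i j → r (![a, b, c, d, e] i) (![a, b, c, d, e] j) := by
    intro i j h
    fin_cases i <;> fin_cases j <;> simp_all [U5, T5]
  refine ⟨![a, b, c, d, e], fun i j hij => ?_, hU⟩
  by_contra hne
  have : U5 i j ∨ U5 j i := by
    fin_cases i <;> fin_cases j <;> simp_all [U5, T5]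
  rcases this with h | h
  · exact hT.irrefl _ (hij ▸ hU i j h)
  · exact hT.irrefl _ (hij ▸ hU j i h)

theorem copy_W5_of_rel (hT : IsTournament r) {v a b c d : V} (va : r v a) (vc : r v c)
    (bv : r b v) (dv : r d v) (ab : r a b) (ac : r a c) (ad : r a d) (bc : r b c) (bd : r b d)
    (cd : r c d) : Copy r W5 := by
  have hW : ∀ i j, W5 i j → r (![v, a, b, c, d] i) (![v, a, b, c, d] j) := by
    intro i j h
    fin_cases i <;> fin_cases j <;> simp_all [W5]
  refine ⟨![v, a, b, c, d], fun i j hij => ?_, hW⟩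
  by_contra hne
  have : W5 i j ∨ W5 j i := by
    fin_cases i <;> fin_cases j <;> simp_all [W5]
  rcases this with h | h
  · exact hT.irrefl _ (hij ▸ hW i j h)
  · exact hT.irrefl _ (hij ▸ hW j i h)

/-- A sixth vertex with a single out-neighbour, or with out-neighbours `a, c` or `a, b, d` or
`a, b, c, d` on a copy of `T5`, yields both `U5` and `W5`. -/
theorem IsPentagon.copies_of_outside (hT : IsTournament r) {a b c d e x : V}
    (h : IsPentagon r a b c d e)
    (hx : (r x a ∧ r b x ∧ r c x ∧ r d x ∧ r e x) ∨ (r x a ∧ r b x ∧ r x c ∧ r d x ∧ r e x) ∨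
      (r x a ∧ r x b ∧ r c x ∧ r x d ∧ r e x) ∨ (r x a ∧ r x b ∧ r x c ∧ r x d ∧ r e x)) :
    Copy r U5 ∧ Copy r W5 := by
  obtain ⟨⟨ab, bc, cd, de, ea⟩, ac, bd, ce, da, eb⟩ := h
  rcases hx with ⟨xa, xb, xc, xd, xe⟩ | ⟨xa, xb, xc, xd, xe⟩ | ⟨xa, xb, xc, xd, xe⟩ |
    ⟨xa, xb, xc, xd, xe⟩
  · constructor
    · apply copy_U5_of_rel hT (a := x) (b := e) (c := a) (d := b) (e := c) <;> assumption
    · apply copy_W5_of_rel hT (v := b) (a := d) (b := e) (c := x) (d := a) <;> assumption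
  · constructor
    · apply copy_U5_of_rel hT (a := c) (b := b) (c := d) (d := x) (e := a) <;> assumption
    · apply copy_W5_of_rel hT (v := b) (a := d) (b := e) (c := x) (d := a) <;> assumption
  · constructor
    · apply copy_U5_of_rel hT (a := d) (b := c) (c := e) (d := x) (e := b) <;> assumption
    · apply copy_W5_of_rel hT (v := d) (a := e) (b := x) (c := a) (d := b) <;> assumption
  · constructor
    · apply copy_U5_of_rel hT (a := a) (b := x) (c := c) (d := d) (e := e) <;> assumption
    · apply copy_W5_of_rel hT (v := d) (a := e) (b := x) (c := a) (d := b) <;> assumption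

/-- If `U5` or `W5` is missing, a vertex dominates a copy of `T5`, is dominated by it, or can
replace one of its vertices. -/
theorem IsPentagon.dominates_or_absorb (hT : IsTournament r) (hn : ¬ (Copy r U5 ∧ Copy r W5))
    {a b c d e : V} (h : IsPentagon r a b c d e) (x : V) :
    (r x a ∧ r x b ∧ r x c ∧ r x d ∧ r x e) ∨ (r a x ∧ r b x ∧ r c x ∧ r d x ∧ r e x) ∨
    IsPentagon r x b c d e ∨ IsPentagon r a x c d e ∨ IsPentagon r a b x d e ∨
      IsPentagon r a b c x e ∨ IsPentagon r a b c d x := by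
  by_cases hxa : x = a
  · subst hxa; tauto
  by_cases hxb : x = b
  · subst hxb; tauto
  by_cases hxc : x = c
  · subst hxc; tauto
  by_cases hxd : x = d
  · subst hxd; tauto
  by_cases hxe : x = e
  · subst hxe; tauto
  have n1 := fun hx => hn (h.copies_of_outside (x := x) hT hx)
  have n2 := fun hx => hn (h.rotate.copies_of_outside (x := x) hT hx)
  have n3 := fun hx => hn (h.rotate.rotate.copies_of_outside (x := x) hT hx)
  have n4 := fun hx => hn (h.rotate.rotate.rotate.copies_of_outside (x := x) hT hx)
  have n5 := fun hx => hn (h.rotate.rotate.rotate.rotate.copies_of_outside (x := x) hT hx)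
  obtain ⟨⟨h1, h2, h3, h4, h5⟩, h6, h7, h8, h9, h10⟩ := h
  clear hn
  rcases hT.total hxa with ha | ha <;> rcases hT.total hxb with hb | hb <;>
    rcases hT.total hxc with hc | hc <;> rcases hT.total hxd with hd | hd <;>
    rcases hT.total hxe with he | he <;>
    simp only [IsPentagon, *, hT.asymm ha, hT.asymm hb, hT.asymm hc, hT.asymm hd, hT.asymm he,
      and_true, and_self, or_true, imp_false, not_true_eq_false,
      not_false_eq_true, and_false, or_self, or_false] at n1 n2 n3 n4 n5 ⊢

theorem IsPentagon.absorb_dominated (hT : IsTournament r) (hn : ¬ (Copy r U5 ∧ Copy r W5))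
    {a b c d e y z : V} (hy : IsPentagon r y b c d e)
    (hz : (r z a ∧ r z b ∧ r z c ∧ r z d ∧ r z e)) : r z y := by
  have as := @IsTournament.asymm V r hT
  have := hy.dominates_or_absorb hT hn z
  unfold IsPentagon at *
  grind

theorem IsPentagon.absorb_dominates (hT : IsTournament r) (hn : ¬ (Copy r U5 ∧ Copy r W5))
    {a b c d e y z : V} (hy : IsPentagon r y b c d e)
    (hz : (r a z ∧ r b z ∧ r c z ∧ r d z ∧ r e z)) : r y z := by
  have as := @IsTournament.asymm V r hT
  have := hy.dominates_or_absorb hT hn z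
  unfold IsPentagon at *
  grind

theorem pentagonsAbsorb_of_isPrime (hT : IsTournament r) (hP : IsPrime r)
    (hn : ¬ (Copy r U5 ∧ Copy r W5)) : PentagonsAbsorb r := by
  intro a b c d e h
  have hhom : IsHomog r {x | IsPentagon r x b c d e ∨ IsPentagon r a x c d e ∨
      IsPentagon r a b x d e ∨ IsPentagon r a b c x e ∨ IsPentagon r a b c d x} := by
    intro z hz
    rcases h.dominates_or_absorb hT hn z with ⟨za, zb, zc, zd, ze⟩ | ⟨za, zb, zc, zd, ze⟩ | hz'
    · left
      rintro y (hy | hy | hy | hy | hy)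
      · exact hy.absorb_dominated hT hn ⟨za, zb, zc, zd, ze⟩
      · exact hy.rotate.absorb_dominated hT hn ⟨zb, zc, zd, ze, za⟩
      · exact hy.rotate.rotate.absorb_dominated hT hn ⟨zc, zd, ze, za, zb⟩
      · exact hy.rotate.rotate.rotate.absorb_dominated hT hn ⟨zd, ze, za, zb, zc⟩
      · exact hy.rotate.rotate.rotate.rotate.absorb_dominated hT hn ⟨ze, za, zb, zc, zd⟩
    · right
      rintro y (hy | hy | hy | hy | hy)
      · exact hy.absorb_dominates hT hn ⟨za, zb, zc, zd, ze⟩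
      · exact hy.rotate.absorb_dominates hT hn ⟨zb, zc, zd, ze, za⟩
      · exact hy.rotate.rotate.absorb_dominates hT hn ⟨zc, zd, ze, za, zb⟩
      · exact hy.rotate.rotate.rotate.absorb_dominates hT hn ⟨zd, ze, za, zb, zc⟩
      · exact hy.rotate.rotate.rotate.rotate.absorb_dominates hT hn ⟨ze, za, zb, zc, zd⟩
    · exact absurd hz' hz
  intro x
  rcases hP _ hhom with hs | hu
  · have hab : a = b := hs (Or.inl h) (Or.inr (Or.inl h))
    exact absurd (hab ▸ h.1.1) (hT.irrefl b)
  · exact hu.ge (Set.mem_univ x)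

theorem PentagonsAbsorb.rel_next (hT : IsTournament r) (hQ : PentagonsAbsorb r)
    {a b c d e x y : V} (hx : IsPentagon r x b c d e)
    (hy : IsPentagon r a y c d e) : r x y := by
  have as := @IsTournament.asymm V r hT
  have hne : x ≠ y := by
    rintro rfl
    exact hT.asymm hx.2.2.2.2.1 hy.2.2.1
  have := hT.total hne
  have := hQ _ _ _ _ _ hx y
  unfold IsPentagon at *
  grind

theorem PentagonsAbsorb.rel_of_rel_second (hT : IsTournament r) (hQ : PentagonsAbsorb r)
    {a b c d e x y : V} (hx : IsPentagon r x b c d e)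
    (hy : IsPentagon r a b y d e) (h : r y x) : r x a := by
  have as := @IsTournament.asymm V r hT
  have hne : x ≠ a := by
    rintro rfl
    exact hT.asymm h hy.2.1
  have := hT.total hne
  have := hQ _ _ _ _ _ hy x
  unfold IsPentagon at *
  grind

/-- A vertex outside the class of `a` splits this class into two sets, one dominating the other. -/
theorem PentagonsAbsorb.rel_of_separates (hT : IsTournament r) (hQ : PentagonsAbsorb r)
    {b c d e s t z : V} (hs : IsPentagon r s b c d e)
    (ht : IsPentagon r t b c d e) (hz : ¬ IsPentagon r z b c d e) (hsz : r s z) (hzt : r z t) :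
    r t s := by
  have as := @IsTournament.asymm V r hT
  rcases hQ _ _ _ _ _ hs z with h | h | h | h | h
  · exact absurd h hz
  · exact absurd hzt (as (hQ.rel_next hT ht h))
  · exact hQ.rel_of_rel_second hT ht h hzt
  · exact absurd hsz (as h.2.2.2.2.1)
  · exact absurd hsz (as h.1.2.2.2.2)

theorem PentagonsAbsorb.isTransOn_class (hT : IsTournament r) (hP : IsPrime r)
    (hQ : PentagonsAbsorb r) (b c d e : V) : IsTransOn r {x | IsPentagon r x b c d e} := by
  rintro p hp q hq s hs ⟨hpq, hqs, hsp⟩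
  let R : V → V → Prop := fun x y => r x y ∧ IsPentagon r x b c d e ∧ IsPentagon r y b c d e
  let S : Set V := {y | Relation.ReflTransGen R p y ∧ Relation.ReflTransGen R y p}
  have hmem : ∀ y ∈ S, IsPentagon r y b c d e := by
    rintro y ⟨hy, -⟩
    induction hy with
    | refl => exact hp
    | tail _ h _ => exact h.2.2
  have hhom : IsHomog r S := by
    intro z hz
    by_contra! hcon
    obtain ⟨⟨s, hsS, hzs⟩, t, htS, hzt⟩ := hcon
    have hsz : r s z := (hT.total (by rintro rfl; exact hz hsS)).resolve_right hzs
    have hzt : r z t := (hT.total (by rintro rfl; exact hz htS)).resolve_right hzt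
    have hsM := hmem s hsS
    have htM := hmem t htS
    by_cases hzM : IsPentagon r z b c d e
    · exact hz ⟨hsS.1.tail ⟨hsz, hsM, hzM⟩, .head ⟨hzt, hzM, htM⟩ htS.2⟩
    · have key : ∀ y, Relation.ReflTransGen R s y → r y z := by
        intro y hy
        induction hy with
        | refl => exact hsz
        | @tail y y' _ h ih =>
          by_contra hn
          have hne : y' ≠ z := by
            rintro rfl
            exact hzM h.2.2
          exact hT.asymm h.1 (hQ.rel_of_separates hT h.2.1 h.2.2 hzM ih
            ((hT.total hne).resolve_left hn))
      exact hT.asymm hzt (key t (hsS.2.trans htS.1))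
  rcases hP S hhom with h | h
  · have hpS : p ∈ S := ⟨.refl, .refl⟩
    have hqS : q ∈ S := ⟨.single ⟨hpq, hp, hq⟩, .head ⟨hqs, hq, hs⟩ (.single ⟨hsp, hs, hp⟩)⟩
    exact hT.irrefl q (h hpS hqS ▸ hpq)
  · exact hT.irrefl b (hmem b (h ▸ Set.mem_univ b)).1.1

theorem PentagonsAbsorb.exists_isPentagon (hQ : PentagonsAbsorb r) (h5 : Copy r T5) (v : V) :
    ∃ b c d e, IsPentagon r v b c d e := by
  obtain ⟨a, b, c, d, e, h⟩ := h5.exists_isPentagon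
  rcases hQ _ _ _ _ _ h v with h | h | h | h | h
  · exact ⟨_, _, _, _, h⟩
  · exact ⟨_, _, _, _, h.rotate⟩
  · exact ⟨_, _, _, _, h.rotate.rotate⟩
  · exact ⟨_, _, _, _, h.rotate.rotate.rotate⟩
  · exact ⟨_, _, _, _, h.rotate.rotate.rotate.rotate⟩

theorem PentagonsAbsorb.isTransOn_out (hT : IsTournament r) (hP : IsPrime r)
    (hQ : PentagonsAbsorb r) (h5 : Copy r T5) (v : V) : IsTransOn r {x | r v x} := by
  obtain ⟨b, c, d, e, hv⟩ := hQ.exists_isPentagon h5 v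
  have tA := hQ.isTransOn_class hT hP b c d e
  have tB := hQ.isTransOn_class hT hP c d e v
  have tC := hQ.isTransOn_class hT hP d e v b
  have cls : ∀ x, r v x → IsPentagon r x b c d e ∨ IsPentagon r x c d e v ∨
      IsPentagon r x d e v b := by
    intro x hx
    rcases hQ _ _ _ _ _ hv x with h | h | h | h | h
    · exact .inl h
    · exact .inr (.inl h.rotate)
    · exact .inr (.inr h.rotate.rotate)
    · exact absurd hx (hT.asymm h.2.2.2.2.1)
    · exact absurd hx (hT.asymm h.1.2.2.2.2)
  have AB : ∀ x y, IsPentagon r x b c d e → IsPentagon r y c d e v → ¬ r y x := fun x y hx hy =>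
    hT.asymm (hQ.rel_next hT hx hy.rotate.rotate.rotate.rotate)
  have BC : ∀ x y, IsPentagon r x c d e v → IsPentagon r y d e v b → ¬ r y x := fun x y hx hy =>
    hT.asymm (hQ.rel_next hT hx hy.rotate.rotate.rotate.rotate)
  have AC : ∀ x y, r v x → IsPentagon r x b c d e → IsPentagon r y d e v b → ¬ r y x :=
    fun x y hvx hx hy hyx => hT.asymm hvx (hQ.rel_of_rel_second hT hx hy.rotate.rotate.rotate hyx)
  rintro p hp q hq s hs ⟨hpq, hqs, hsp⟩
  rcases cls p hp with h1 | h1 | h1 <;> rcases cls q hq with h2 | h2 | h2 <;>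
    rcases cls s hs with h3 | h3 | h3 <;>
    first
    | exact tA p h1 q h2 s h3 ⟨hpq, hqs, hsp⟩
    | exact tB p h1 q h2 s h3 ⟨hpq, hqs, hsp⟩
    | exact tC p h1 q h2 s h3 ⟨hpq, hqs, hsp⟩
    | exact AB _ _ h1 h3 hsp
    | exact AB _ _ h2 h1 hpq
    | exact AB _ _ h3 h2 hqs
    | exact BC _ _ h1 h3 hsp
    | exact BC _ _ h2 h1 hpq
    | exact BC _ _ h3 h2 hqs
    | exact AC _ _ hp h1 h3 hsp
    | exact AC _ _ hq h2 h1 hpq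
    | exact AC _ _ hs h3 h2 hqs

theorem IsTransOn.rel_trans (hT : IsTournament r) {X : Set V} (hX : IsTransOn r X) {a b c : V}
    (ha : a ∈ X) (hb : b ∈ X) (hc : c ∈ X) (hab : r a b) (hbc : r b c) : r a c := by
  have hne : a ≠ c := by
    rintro rfl
    exact hT.asymm hab hbc
  exact (hT.total hne).resolve_right fun h => hX a ha b hb c hc ⟨hab, hbc, h⟩

theorem exists_source_out [Finite V] (hT : IsTournament r) {v : V}
    (hv : IsTransOn r {x | r v x}) (hne : ∃ u, r v u) :
    ∃ u, r v u ∧ ∀ z, r v z → z ≠ u → r u z := by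
  let R : {x | r v x} → {x | r v x} → Prop := fun x y => r x y
  have : IsTrans _ R := ⟨fun x y z => hv.rel_trans hT x.2 y.2 z.2⟩
  have : Std.Irrefl R := ⟨fun x => hT.irrefl x.1⟩
  obtain ⟨u₀, hu₀⟩ := hne
  obtain ⟨u, -, hu⟩ := (Finite.wellFounded_of_trans_of_irrefl R).has_min Set.univ
    ⟨⟨u₀, hu₀⟩, trivial⟩
  exact ⟨u, u.2, fun z hz hzu => (hT.total hzu).resolve_left (hu ⟨z, hz⟩ trivial)⟩

/-- In a tournament with transitive out-neighbourhoods and no sink, sending every vertex to the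
source of its out-neighbourhood is a permutation. -/
theorem exists_perm_source_out [Finite V] (hT : IsTournament r)
    (hL : ∀ v, IsTransOn r {x | r v x}) (hne : ∀ v, ∃ u, r v u) :
    ∃ σ : Equiv.Perm V, ∀ v, r v (σ v) ∧ ∀ z, r v z → z ≠ σ v → r (σ v) z := by
  choose f hf using fun v => exists_source_out hT (hL v) (hne v)
  have hinj : Function.Injective f := by
    have key : ∀ u v, f u = f v → ¬ r u v := by
      intro u v h huv
      have hvf : r v (f u) := h ▸ (hf v).1
      have hvne : v ≠ f u := by
        rintro hv
        exact hT.irrefl _ (hv ▸ hvf)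
      exact hT.asymm hvf ((hf u).2 v huv hvne)
    intro u v h
    by_contra huv
    exact (hT.total huv).elim (key u v h) (key v u h.symm)
  exact ⟨Equiv.ofBijective f (Finite.injective_iff_bijective.1 hinj), hf⟩

section Successor

variable {σ : Equiv.Perm V}

theorem rel_symm_apply_of_rel (hT : IsTournament r)
    (hσ : ∀ v, r v (σ v) ∧ ∀ z, r v z → z ≠ σ v → r (σ v) z) {v z : V} (h : r v (σ z))
    (hne : v ≠ z) : r v z := by
  refine (hT.total hne).resolve_right fun hzv => hT.asymm h ((hσ z).2 v hzv ?_)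
  rintro rfl
  exact hT.irrefl _ h

theorem sameCycle_of_rel [Finite V] (hT : IsTournament r) (hL : ∀ v, IsTransOn r {x | r v x})
    (hσ : ∀ v, r v (σ v) ∧ ∀ z, r v z → z ≠ σ v → r (σ v) z) {v z : V} (h : r v z) :
    σ.SameCycle v z := by
  by_contra hc
  have hcancel : ∀ x, σ (σ⁻¹ x) = x := σ.apply_symm_apply
  have hout : ∀ m : ℕ, r v ((σ⁻¹ ^ m) z) := by
    intro m
    induction m with
    | zero => exact h
    | succ m ih =>
      rw [pow_succ', Equiv.Perm.mul_apply]
      apply rel_symm_apply_of_rel hT hσ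
      · rwa [hcancel]
      · intro hv
        apply hc
        rw [hv, ← Equiv.Perm.mul_apply, ← pow_succ', ← Equiv.Perm.sameCycle_inv]
        exact (Equiv.Perm.sameCycle_pow_left).2 (.refl _ _)
  have hin : ∀ m : ℕ, r ((σ⁻¹ ^ (m + 1)) z) z := by
    intro m
    have step : ∀ m : ℕ, r ((σ⁻¹ ^ (m + 1)) z) ((σ⁻¹ ^ m) z) := by
      intro m
      have := (hσ ((σ⁻¹ ^ (m + 1)) z)).1
      rwa [pow_succ', Equiv.Perm.mul_apply, hcancel, ← Equiv.Perm.mul_apply, ← pow_succ'] at this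
    induction m with
    | zero => exact step 0
    | succ m ih => exact (hL v).rel_trans hT (hout _) (hout _) h (step _) ih
  have := hin (orderOf σ⁻¹ - 1)
  rw [Nat.sub_add_cancel (orderOf_pos σ⁻¹), pow_orderOf_eq_one] at this
  exact hT.irrefl _ this

theorem sameCycle_of_isPrime [Finite V] (hT : IsTournament r) (hP : IsPrime r)
    (hL : ∀ v, IsTransOn r {x | r v x})
    (hσ : ∀ v, r v (σ v) ∧ ∀ z, r v z → z ≠ σ v → r (σ v) z) (v z : V) :
    σ.SameCycle v z := by
  have hhom : IsHomog r {x | σ.SameCycle v x} := by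
    intro z hz
    left
    intro x hx
    refine (hT.total ?_).resolve_right fun h => hz (hx.trans (sameCycle_of_rel hT hL hσ h))
    rintro rfl
    exact hz hx
  rcases hP _ hhom with h | h
  · have : v = σ v := h (.refl _ _) (Equiv.Perm.sameCycle_apply_right.2 (.refl _ _))
    exact absurd (hσ v).1 (this ▸ hT.irrefl v)
  · exact h.ge (Set.mem_univ z)

theorem exists_rel_cyclic_of_isPrime (hT : IsTournament r) (hP : IsPrime r)
    (hσ : ∀ v, r v (σ v) ∧ ∀ z, r v z → z ≠ σ v → r (σ v) z) (v : V) :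
    ∃ w, r w v ∧ r (σ v) w := by
  by_contra! hcon
  have hhom : IsHomog r {v, σ v} := by
    intro w hw
    simp only [Set.mem_insert_iff, Set.mem_singleton_iff, not_or] at hw
    rcases hT.total hw.1 with h | h
    · left
      rintro x (rfl | rfl)
      · exact h
      · exact (hT.total hw.2).resolve_right (hcon w h)
    · right
      rintro x (rfl | rfl)
      · exact h
      · exact (hσ v).2 w h hw.2
  rcases hP _ hhom with h | h
  · have : v = σ v := h (.inl rfl) (.inr rfl)
    exact absurd (hσ v).1 (this ▸ hT.irrefl v)
  · rcases h.ge (Set.mem_univ (σ (σ v))) with h' | h'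
    · have := (hσ (σ v)).1
      rw [h'] at this
      exact hT.asymm this (hσ v).1
    · have := (hσ (σ v)).1
      rw [h'] at this
      exact hT.irrefl _ this

end Successor

theorem Tn_iff_of_le {n : ℕ} {i j : Fin n} (h : i ≤ j) :
    Tn n i j ↔ 1 ≤ j.val - i.val ∧ j.val - i.val ≤ (n - 1) / 2 := by
  have h1 : i.val ≤ j.val := h
  have h2 := j.2
  rw [Tn, show j.val + n - i.val = j.val - i.val + n by omega, Nat.add_mod_right,
    Nat.mod_eq_of_lt (by omega)]

theorem Tn_iff_of_lt {n : ℕ} {i j : Fin n} (h : j < i) :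
    Tn n i j ↔ j.val + n - i.val ≤ (n - 1) / 2 := by
  have h1 : j.val < i.val := h
  have h2 := i.2
  rw [Tn, Nat.mod_eq_of_lt (by omega)]
  omega

/-- A prime tournament with transitive out-neighbourhoods and no sink is some `Tn`. -/
theorem exists_equiv_Tn [Fintype V] [Nonempty V] (hT : IsTournament r) (hP : IsPrime r)
    (hL : ∀ v, IsTransOn r {x | r v x}) (hne : ∀ v, ∃ u, r v u) :
    ∃ n : ℕ, Odd n ∧ ∃ e : V ≃ Fin n, ∀ u v : V, r u v ↔ Tn n (e u) (e v) := by
  obtain ⟨σ, hσ⟩ := exists_perm_source_out hT hL hne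
  have hsc := sameCycle_of_isPrime hT hP hL hσ
  have hcyc : σ.IsCycleOn (Finset.univ : Finset V) := by
    rw [Finset.coe_univ]
    exact ⟨Set.bijOn_univ.2 σ.bijective, fun x _ y _ => hsc x y⟩
  obtain ⟨n, hn⟩ : ∃ n, Fintype.card V = n := ⟨_, rfl⟩
  have hpow : ∀ u v, ∃ k < n, (σ ^ k) u = v := by
    intro u v
    have := hcyc.exists_pow_eq (Finset.mem_univ u) (Finset.mem_univ v)
    rwa [Finset.card_univ, hn] at this
  have hper : ∀ u, (σ ^ n) u = u := by
    intro u
    have := hcyc.pow_card_apply (Finset.mem_univ u)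
    rwa [Finset.card_univ, hn] at this
  have hfix : ∀ u k, 0 < k → k < n → (σ ^ k) u ≠ u := by
    intro u k hk hkn h
    have := (hcyc.pow_apply_eq (Finset.mem_univ u)).1 h
    rw [Finset.card_univ, hn] at this
    exact absurd (Nat.le_of_dvd hk this) (by omega)
  have hdown : ∀ v j k, 0 < j → j ≤ k → k < n → r v ((σ ^ k) v) → r v ((σ ^ j) v) := by
    intro v j k hj hjk
    induction k, hjk using Nat.le_induction with
    | base => exact fun _ h => h
    | succ k hk ih =>
      intro hkn h
      rw [pow_succ', Equiv.Perm.mul_apply] at h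
      exact ih (by omega) (rel_symm_apply_of_rel hT hσ h (hfix v k (by omega) (by omega)).symm)
  have hshift : ∀ v k, k < n → r v ((σ ^ k) v) → r (σ v) ((σ ^ k) (σ v)) := by
    intro v k hkn h
    have hk : k ≠ 0 := by
      rintro rfl
      exact hT.irrefl _ h
    by_contra hcon
    obtain ⟨w, hwv, hvw⟩ := exists_rel_cyclic_of_isPrime hT hP hσ v
    obtain ⟨j, hjn, rfl⟩ := hpow (σ v) w
    have hjk : j < k := by
      by_contra hkj
      exact hcon (hdown _ k j (by omega) (by omega) hjn hvw)
    rw [← Equiv.Perm.mul_apply, ← pow_succ] at hwv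
    exact hT.asymm hwv (hdown v (j + 1) k (by omega) hjk hkn h)
  have hinv : ∀ u v k, k < n → r u ((σ ^ k) u) → r v ((σ ^ k) v) := by
    intro u v k hkn h
    obtain ⟨m, -, rfl⟩ := hpow u v
    clear hdown
    induction m with
    | zero => exact h
    | succ m ih =>
      rw [pow_succ' σ m, Equiv.Perm.mul_apply]
      exact hshift _ _ hkn ih
  obtain ⟨v₀⟩ := ‹Nonempty V›
  have hcompl : ∀ k, 0 < k → k < n → (r v₀ ((σ ^ k) v₀) ↔ ¬ r v₀ ((σ ^ (n - k)) v₀)) := by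
    intro k hk hkn
    have hback : r v₀ ((σ ^ (n - k)) v₀) ↔ r ((σ ^ k) v₀) v₀ := by
      have hret : (σ ^ (n - k)) ((σ ^ k) v₀) = v₀ := by
        rw [← Equiv.Perm.mul_apply, ← pow_add, Nat.sub_add_cancel hkn.le, hper]
      constructor
      · intro h
        simpa only [hret] using hinv v₀ ((σ ^ k) v₀) (n - k) (by omega) h
      · intro h
        exact hinv ((σ ^ k) v₀) v₀ (n - k) (by omega) (by rwa [hret])
    rw [hback]
    exact hT.2 _ _ (hfix v₀ k hk hkn).symm
  have hodd : Odd n := by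
    rw [← Nat.not_even_iff_odd]
    rintro ⟨m, hm⟩
    have hpos : 0 < n := hn ▸ Fintype.card_pos_iff.2 ⟨v₀⟩
    have := hcompl m (by omega) (by omega)
    rw [show n - m = m by omega] at this
    tauto
  have hrel : ∀ u k, k < n → (r u ((σ ^ k) u) ↔ 1 ≤ k ∧ k ≤ (n - 1) / 2) := by
    intro u k hkn
    obtain ⟨m, hm⟩ := hodd
    have h0 : r u ((σ ^ k) u) ↔ r v₀ ((σ ^ k) v₀) := ⟨hinv u v₀ k hkn, hinv v₀ u k hkn⟩
    have hle : ∀ k, 0 < k → k ≤ m → r v₀ ((σ ^ k) v₀) := by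
      intro k hk hkm
      by_contra h
      have := not_not.1 (mt (hcompl k hk (by omega)).2 h)
      exact h (hdown v₀ k (n - k) hk (by omega) (by omega) this)
    rw [h0]
    constructor
    · intro h
      have hk : k ≠ 0 := by
        rintro rfl
        exact hT.irrefl _ h
      by_contra hcon
      exact (hcompl k (by omega) hkn).1 h (hle (n - k) (by omega) (by omega))
    · intro h
      exact hle k (by omega) (by omega)
  have hbij : Function.Bijective fun i : Fin n => (σ ^ i.val) v₀ := by
    rw [Fintype.bijective_iff_surjective_and_card]
    refine ⟨fun z => ?_, by simp [hn]⟩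
    obtain ⟨k, hk, h⟩ := hpow v₀ z
    exact ⟨⟨k, hk⟩, h⟩
  refine ⟨n, hodd, (Equiv.ofBijective _ hbij).symm, fun u v => ?_⟩
  obtain ⟨i, rfl⟩ := (Equiv.ofBijective _ hbij).surjective u
  obtain ⟨j, rfl⟩ := (Equiv.ofBijective _ hbij).surjective v
  rw [Equiv.symm_apply_apply, Equiv.symm_apply_apply]
  simp only [Equiv.ofBijective_apply]
  rcases le_or_gt i j with h | h
  · have hij : i.val ≤ j.val := h
    rw [Tn_iff_of_le h, ← hrel ((σ ^ i.val) v₀) _ (by omega), ← Equiv.Perm.mul_apply, ← pow_add,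
      Nat.sub_add_cancel hij]
  · have hji : j.val < i.val := h
    have := hrel ((σ ^ i.val) v₀) (j.val + n - i.val) (by omega)
    rw [← Equiv.Perm.mul_apply, ← pow_add, Nat.sub_add_cancel (by omega), pow_add,
      Equiv.Perm.mul_apply, hper] at this
    rw [this, Tn_iff_of_lt h]
    omega

end Tournament

/-- A prime tournament containing T_5 is either T_n for some odd n, or
contains both U_5 and W_5. -/
theorem prime_contains_T5 {V : Type*} [Fintype V] (r : V → V → Prop)
    (hT : IsTournament r) (hP : IsPrime r) (hT5 : Copy r T5) :
    (∃ n : ℕ, Odd n ∧ ∃ e : V ≃ Fin n, ∀ u v : V, r u v ↔ Tn n (e u) (e v)) ∨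
      (Copy r U5 ∧ Copy r W5) := by
  rw [or_iff_not_imp_right]
  intro hn
  have hQ := pentagonsAbsorb_of_isPrime hT hP hn
  have : Nonempty V := ⟨hT5.choose 0⟩
  refine exists_equiv_Tn hT hP (fun v => hQ.isTransOn_out hT hP hT5 v) fun v => ?_
  obtain ⟨b, _, _, _, h⟩ := hQ.exists_isPentagon hT5 v
  exact ⟨b, h.1.1⟩
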